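/- arXiv:1508.01840 — 5 statements merged into one kernel-verified Lean document; each statement's English description precedes it below -/
import Mathlib

section
/- Fix an integer k ≥ 1 and nonnegative integers b_1, …, b_k with b_1 + ⋯ + b_k ≥ 2, and let (a_n)_{n≥0} be a sequence of positive integers satisfying a_n = Σ_{i=1}^k b_i·a_{n−i} for all n ≥ k. Define the rotated sequences a^(r) and the sequence q : ℤ → ℤ as in the construction. Then q eventually satisfies the recurrence q(n) = q(n − q(n−2)) + Σ_{i=1}^k b_i·q(n − q(n−(2i−1))) (i.e., there exists N such that this equation holds for all n ≥ N), and q(2k·n) = a_n for all n ≥ 0; that is, q is a meta-Fibonacci-type solution containing (a_n) as its subsequence of quasi-period 2k. -/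
open Finset in
theorem sum_Icc_one_split {M : Type*} [AddCommMonoid M] {j k : ℕ} (hj : j ≤ k) (f : ℕ → M) :
    ∑ i ∈ Icc 1 k, f i = ∑ i ∈ Icc 1 j, f i + ∑ i ∈ Icc (j + 1) k, f i := by
  rw [← sum_union]
  · congr 1
    ext i
    simp only [mem_union, mem_Icc]
    omega
  · rw [disjoint_left]
    simp only [mem_Icc]
    omega

open Finset in
/-- A positive solution of a rotated recurrence with coefficient sum at least `2` at least doubles
every `k` steps. -/
theorem two_pow_div_le_of_rotated_rec {k r : ℕ} (hr : r < k) {b : ℕ → ℕ}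
    (hb : 2 ≤ ∑ i ∈ Icc 1 k, b i) {u : ℕ → ℤ} (hu_init : ∀ n < k, 0 < u n)
    (hu_rec : ∀ n, k ≤ n → u n = (∑ i ∈ Icc 1 r, (b i : ℤ) * u (n - (k + i - r)))
      + ∑ i ∈ Icc (r + 1) k, (b i : ℤ) * u (n - (i - r))) (n : ℕ) :
    2 ^ (n / k) ≤ u n := by
  induction n using Nat.strong_induction_on with
  | _ n ih =>
    rcases lt_or_ge n k with hn | hn
    · rw [Nat.div_eq_of_lt hn]
      have := hu_init n hn
      simp only [pow_zero]
      omega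
    · have lag : ∀ l, 1 ≤ l → l ≤ k → (2 : ℤ) ^ (n / k - 1) ≤ u (n - l) := by
        intro l h1 h2
        refine le_trans (pow_le_pow_right₀ one_le_two ?_) (ih (n - l) (by omega))
        rw [← Nat.sub_mul_div_of_le n k 1 (by simpa using hn)]
        exact Nat.div_le_div_right (by omega)
      have hpos : 1 ≤ n / k := (Nat.one_le_div_iff (by omega)).2 hn
      calc (2 : ℤ) ^ (n / k) = 2 * 2 ^ (n / k - 1) := by
            rw [← pow_succ', Nat.sub_add_cancel hpos]
        _ ≤ (∑ i ∈ Icc 1 k, (b i : ℤ)) * 2 ^ (n / k - 1) := by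
            gcongr
            exact_mod_cast hb
        _ ≤ u n := by
            rw [hu_rec n hn, sum_mul, sum_Icc_one_split hr.le]
            gcongr with i hi i hi
            all_goals
              rw [mem_Icc] at hi
              exact lag _ (by omega) (by omega)

open Filter in
theorem eventually_linear_lt_two_pow_div {k : ℕ} (hk : 1 ≤ k) (C : ℕ) :
    ∀ᶠ m : ℕ in atTop, C * (m + 2) < 2 ^ (m / k) := by
  have h : ∀ᶠ t : ℕ in atTop, C * (k * 3) * t < 2 ^ t := by
    have := (tendsto_pow_const_div_const_pow_of_one_lt 1 (one_lt_two (α := ℝ))).const_mul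
      ((C * (k * 3) : ℕ) : ℝ)
    rw [mul_zero] at this
    filter_upwards [this.eventually_lt_const one_pos] with t ht
    rw [pow_one, ← mul_div_assoc, div_lt_one (by positivity)] at ht
    exact_mod_cast ht
  have hdiv : Tendsto (fun m : ℕ => m / k) atTop atTop :=
    Nat.tendsto_div_const_atTop (by omega)
  filter_upwards [hdiv.eventually h, hdiv.eventually_ge_atTop 2] with m hm h2
  refine lt_of_le_of_lt ?_ hm
  rw [mul_assoc]
  refine Nat.mul_le_mul_left C ?_
  have := Nat.div_add_mod m k
  have := Nat.mod_lt m hk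
  nlinarith


/-- The construction. Given the rotated sequences `A r` and the
interleaved sequence `q` built from them, `q` eventually satisfies the meta-Fibonacci
recurrence `q n = q (n - q (n-2)) + ∑_{i=1}^k b i * q (n - q (n - (2i-1)))`, and
`q (2kn) = a n` for all `n ≥ 0`. -/
theorem construction_is_meta_fibonacci
    (k : ℕ) (hk : 1 ≤ k) (b : ℕ → ℕ)
    (hb : 2 ≤ ∑ i ∈ Finset.Icc 1 k, b i)
    (a : ℕ → ℤ) (ha_pos : ∀ n, 0 < a n)
    (ha_rec : ∀ n, k ≤ n → a n = ∑ i ∈ Finset.Icc 1 k, (b i : ℤ) * a (n - i))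
    (A : ℕ → ℕ → ℤ)
    (hA_init : ∀ r < k, ∀ n < k, A r n = a n)
    (hA_rec : ∀ r < k, ∀ n, k ≤ n →
      A r n = (∑ i ∈ Finset.Icc 1 r, (b i : ℤ) * A r (n - (k + i - r)))
            + (∑ i ∈ Finset.Icc (r + 1) k, (b i : ℤ) * A r (n - (i - r))))
    (q : ℤ → ℤ)
    (hq_neg : ∀ m : ℤ, m < 0 → q m = 0)
    (hq_even : ∀ m : ℕ, ∀ j < k, q (2 * (m : ℤ) * k + 2 * j) = A j m)
    (hq_odd : ∀ m : ℕ, ∀ j < k, q (2 * (m : ℤ) * k + 2 * j + 1) = 2 * k * ((k : ℤ) - j)) :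
    (∃ N : ℤ, ∀ n : ℤ, N ≤ n →
      q n = q (n - q (n - 2)) +
        ∑ i ∈ Finset.Icc 1 k, (b i : ℤ) * q (n - q (n - (2 * (i : ℤ) - 1)))) ∧
    (∀ n : ℕ, q (2 * (k : ℤ) * n) = a n) := by
  have q_even : ∀ (x : ℤ) (m j : ℕ), j < k → x = 2 * (m : ℤ) * k + 2 * j → q x = A j m := by
    rintro x m j hj rfl
    exact hq_even m j hj
  have q_odd : ∀ (x : ℤ) (m j : ℕ), j < k → x = 2 * (m : ℤ) * k + 2 * j + 1 →
      q x = 2 * k * ((k : ℤ) - j) := by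
    rintro x m j hj rfl
    exact hq_odd m j hj
  have decomp : ∀ y : ℕ, ∃ m j : ℕ, j < k ∧ y = m * k + j := fun y =>
    ⟨y / k, y % k, Nat.mod_lt _ hk, (Nat.div_add_mod' y k).symm⟩
  constructor
  · obtain ⟨M, hM⟩ := Filter.eventually_atTop.1 (eventually_linear_lt_two_pow_div hk (2 * k))
    have large : ∀ y : ℕ, (M + 1) * k ≤ y → 2 * (y : ℤ) + 2 * k < q (2 * y) := by
      intro y hy
      obtain ⟨m, j, hj, rfl⟩ := decomp y
      have hm : M ≤ m := by
        by_contra! h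
        have : (m + 1) * k ≤ M * k := Nat.mul_le_mul_right k h
        nlinarith
      rw [q_even _ m j hj (by push_cast; ring)]
      refine lt_of_lt_of_le ?_ (two_pow_div_le_of_rotated_rec hj hb
        (fun n hn => hA_init j hj n hn ▸ ha_pos n) (hA_rec j hj) m)
      have h : (2 * k * (m + 2) : ℤ) < 2 ^ (m / k) := by exact_mod_cast hM m hm
      push_cast
      nlinarith
    have vanish : ∀ (n : ℤ) (y : ℕ), (M + 1) * k ≤ y → n ≤ 2 * y + 2 * k →
        q (n - q (2 * y)) = 0 := by
      intro n y hy hn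
      have := large y hy
      exact hq_neg _ (by omega)
    refine ⟨2 * ((M + k + 3) * k : ℕ), fun n hn => ?_⟩
    obtain ⟨y, hy⟩ := Int.eq_ofNat_of_zero_le (show 0 ≤ n / 2 by omega)
    obtain ⟨m, j, hj, hmj⟩ := decomp y
    have hyk : (M + k + 3) * k ≤ y := by omega
    have hm : k + 2 ≤ m := by
      by_contra! h
      have : (m + 1) * k ≤ (k + 2) * k := Nat.mul_le_mul_right k h
      nlinarith
    have hyM : (M + 1) * k + k ≤ y := by nlinarith
    have hyc : (y : ℤ) = m * k + j := by exact_mod_cast hmj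
    rcases Int.emod_two_eq_zero_or_one n with h | h
    · have hn' : n = 2 * y := by omega
      have h0 : q (n - q (n - 2)) = 0 := by
        have := vanish n (y - 1) (by omega) (by omega)
        rwa [show (2 * ((y - 1 : ℕ) : ℤ)) = n - 2 by omega] at this
      rw [h0, zero_add, q_even n m j hj (by rw [hn', hyc]; ring), hA_rec j hj m (by omega),
        sum_Icc_one_split hj.le]
      congr 1
      · refine Finset.sum_congr rfl fun i hi => ?_
        rw [Finset.mem_Icc] at hi
        rw [q_odd (n - (2 * i - 1)) m (j - i) (by omega)
            (by rw [hn', hyc]; push_cast [hi.2]; ring),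
          q_even _ (m - (k + i - j)) j hj]
        rw [hn', hyc, Nat.cast_sub (by omega), Nat.cast_sub (by omega), Nat.cast_sub (by omega)]
        push_cast
        ring
      · refine Finset.sum_congr rfl fun i hi => ?_
        rw [Finset.mem_Icc] at hi
        rw [q_odd (n - (2 * i - 1)) (m - 1) (k + j - i) (by omega)
            (by rw [hn', hyc, Nat.cast_sub (by omega), Nat.cast_sub (by omega)]; push_cast; ring),
          q_even _ (m - (i - j)) j hj]
        rw [hn', hyc, Nat.cast_sub (by omega), Nat.cast_sub (by omega), Nat.cast_sub (by omega)]
        push_cast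
        ring
    · have hn' : n = 2 * y + 1 := by omega
      rw [Finset.sum_eq_zero, add_zero]
      · rw [q_odd n m j hj (by rw [hn', hyc]; ring)]
        symm
        rcases Nat.eq_zero_or_pos j with rfl | hj0
        · rw [q_odd (n - 2) (m - 1) (k - 1) (by omega)
              (by rw [hn', hyc, Nat.cast_sub (by omega), Nat.cast_sub hk]; push_cast; ring),
            q_odd _ (m - 1) 0 hj]
          rw [hn', hyc, Nat.cast_sub (by omega), Nat.cast_sub (by omega)]
          push_cast
          ring
        · rw [q_odd (n - 2) m (j - 1) (by omega)
              (by rw [hn', hyc, Nat.cast_sub hj0]; push_cast; ring),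
            q_odd _ (m - (k - j + 1)) j hj]
          rw [hn', hyc, Nat.cast_sub (by omega), Nat.cast_sub (by omega)]
          push_cast [hj.le]
          ring
      · intro i hi
        rw [Finset.mem_Icc] at hi
        have := vanish n (y + 1 - i) (by omega) (by omega)
        rw [show (2 * ((y + 1 - i : ℕ) : ℤ)) = n - (2 * i - 1) by omega] at this
        rw [this, mul_zero]
  · intro n
    rw [q_even _ n 0 hk (by push_cast; ring)]
    induction n using Nat.strong_induction_on with
    | _ n ih =>
      rcases lt_or_ge n k with hn | hn
      · exact hA_init 0 hk n hn
      · rw [hA_rec 0 hk n hn, ha_rec n hn]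
        simp only [Finset.Icc_eq_empty_of_lt one_pos, Finset.sum_empty, zero_add, Nat.sub_zero]
        refine Finset.sum_congr rfl fun i hi => ?_
        rw [Finset.mem_Icc] at hi
        rw [ih (n - i) (by omega)]
end

section
/- Fix an integer k ≥ 1 and nonnegative integers b_1, …, b_k with b_1 + ⋯ + b_k ≥ 2, and let (a_n)_{n≥0} be a sequence of positive integers satisfying a_n = Σ_{i=1}^k b_i·a_{n−i} for all n ≥ k. Define the rotated sequences a^(r) and the sequence q : ℤ → ℤ as in the construction. Then there exists H such that for every odd integer n ≥ H, q(n) = q(n − q(n−2)) + Σ_{i=1}^k b_i·q(n − q(n−(2i−1))); moreover, for such n, each of the k summands q(n − q(n−(2i−1))) equals 0, and q(n − q(n−2)) = q(n). -/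
/-- A positive sequence in which every late term is at least twice the minimum of the previous
`k` terms grows at least like `2 ^ (n / k)`. -/
lemma two_pow_div_le_of_weighted_recurrence {k : ℕ} (hk : 1 ≤ k) {u : ℕ → ℤ}
    (hpos : ∀ n < k, 0 < u n)
    (hstep : ∀ n, k ≤ n → ∀ c : ℤ, 0 ≤ c → (∀ d, 1 ≤ d → d ≤ k → c ≤ u (n - d)) → 2 * c ≤ u n)
    (n : ℕ) : (2 : ℤ) ^ (n / k) ≤ u n := by
  induction n using Nat.strong_induction_on with
  | _ n ih =>
    rcases lt_or_ge n k with h | h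
    · rw [Nat.div_eq_of_lt h]
      have := hpos n h
      simp only [pow_zero]
      lia
    · have hdiv : n / k = (n - k) / k + 1 := Nat.div_eq_sub_div (by lia) h
      rw [hdiv, pow_succ, mul_comm]
      refine hstep n h _ (by positivity) fun d hd hdk => ?_
      refine le_trans ?_ (ih (n - d) (by lia))
      exact pow_le_pow_right₀ (by norm_num) (Nat.div_le_div_right (by lia))

/-- A nonnegative combination with total weight at least `2` of the `k` previous terms, indexed by
the rotated lags, is at least twice any common lower bound of these terms. -/
lemma two_mul_le_rotated_sum {k r n : ℕ} (hr : r < k) {b : ℕ → ℕ}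
    (hb : 2 ≤ ∑ i ∈ Finset.Icc 1 k, b i) {u : ℕ → ℤ} {c : ℤ} (hc : 0 ≤ c)
    (hu : ∀ d, 1 ≤ d → d ≤ k → c ≤ u (n - d)) :
    2 * c ≤ (∑ i ∈ Finset.Icc 1 r, (b i : ℤ) * u (n - (k + i - r)))
      + (∑ i ∈ Finset.Icc (r + 1) k, (b i : ℤ) * u (n - (i - r))) := by
  have hsplit : ∑ i ∈ Finset.Icc 1 k, (b i : ℤ)
      = (∑ i ∈ Finset.Icc 1 r, (b i : ℤ)) + ∑ i ∈ Finset.Icc (r + 1) k, (b i : ℤ) := by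
    rw [← Finset.sum_union]
    · congr 1
      ext i
      simp only [Finset.mem_Icc, Finset.mem_union]
      lia
    · rw [Finset.disjoint_left]
      intro i
      simp only [Finset.mem_Icc]
      lia
  have hb' : (2 : ℤ) ≤ ∑ i ∈ Finset.Icc 1 k, (b i : ℤ) := by exact_mod_cast hb
  refine (mul_le_mul_of_nonneg_right hb' hc).trans ?_
  rw [hsplit, add_mul, Finset.sum_mul, Finset.sum_mul]
  refine add_le_add (Finset.sum_le_sum fun i hi => ?_) (Finset.sum_le_sum fun i hi => ?_) <;>
  · rw [Finset.mem_Icc] at hi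
    exact mul_le_mul_of_nonneg_left (hu _ (by lia) (by lia)) (by positivity)

lemma mul_add_three_le_two_pow (C : ℕ) {t : ℕ} (ht : 2 * C + 5 ≤ t) : C * (t + 3) ≤ 2 ^ t := by
  have hC : C < 2 ^ C := Nat.lt_two_pow_self
  induction t, ht using Nat.le_induction with
  | base =>
    have : 2 ^ (2 * C + 5) = 32 * (2 ^ C * 2 ^ C) := by ring
    rw [this]
    nlinarith
  | succ t ht ih =>
    have : 2 ^ C ≤ 2 ^ t := Nat.pow_le_pow_right (by norm_num) (by lia)
    rw [pow_succ]
    nlinarith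

/-- For all sufficiently large odd `n`, the constructed sequence `q`
satisfies the meta-Fibonacci recurrence; moreover each summand
`q (n - q (n - (2i-1)))` vanishes and `q (n - q (n-2)) = q n`. -/
theorem odd_case_of_construction
    (k : ℕ) (hk : 1 ≤ k) (b : ℕ → ℕ)
    (hb : 2 ≤ ∑ i ∈ Finset.Icc 1 k, b i)
    (a : ℕ → ℤ) (ha_pos : ∀ n, 0 < a n)
    (ha_rec : ∀ n, k ≤ n → a n = ∑ i ∈ Finset.Icc 1 k, (b i : ℤ) * a (n - i))
    (A : ℕ → ℕ → ℤ)
    (hA_init : ∀ r < k, ∀ n < k, A r n = a n)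
    (hA_rec : ∀ r < k, ∀ n, k ≤ n →
      A r n = (∑ i ∈ Finset.Icc 1 r, (b i : ℤ) * A r (n - (k + i - r)))
            + (∑ i ∈ Finset.Icc (r + 1) k, (b i : ℤ) * A r (n - (i - r))))
    (q : ℤ → ℤ)
    (hq_neg : ∀ m : ℤ, m < 0 → q m = 0)
    (hq_even : ∀ m : ℕ, ∀ j < k, q (2 * (m : ℤ) * k + 2 * j) = A j m)
    (hq_odd : ∀ m : ℕ, ∀ j < k, q (2 * (m : ℤ) * k + 2 * j + 1) = 2 * k * ((k : ℤ) - j)) :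
    ∃ H : ℤ, ∀ n : ℤ, H ≤ n → Odd n →
      (q n = q (n - q (n - 2)) +
        ∑ i ∈ Finset.Icc 1 k, (b i : ℤ) * q (n - q (n - (2 * (i : ℤ) - 1)))) ∧
      (∀ i ∈ Finset.Icc 1 k, q (n - q (n - (2 * (i : ℤ) - 1))) = 0) ∧
      q (n - q (n - 2)) = q n := by
  have growth : ∀ r < k, ∀ n, (2 : ℤ) ^ (n / k) ≤ A r n := fun r hr n =>
    two_pow_div_le_of_weighted_recurrence hk
      (fun m hm => by rw [hA_init r hr m hm]; exact ha_pos m)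
      (fun m hm c hc hu => by rw [hA_rec r hr m hm]; exact two_mul_le_rotated_sum hr hb hc hu) n
  have q_even : ∀ p : ℕ, q (2 * p) = A (p % k) (p / k) := fun p => by
    rw [← hq_even _ _ (Nat.mod_lt p hk)]
    congr 1
    have : (p : ℤ) = k * (p / k : ℕ) + (p % k : ℕ) := by exact_mod_cast (Nat.div_add_mod p k).symm
    linear_combination 2 * this
  have q_odd : ∀ p : ℕ, q (2 * p + 1) = 2 * k * ((k : ℤ) - (p % k : ℕ)) := fun p => by
    rw [← hq_odd (p / k) _ (Nat.mod_lt p hk)]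
    congr 1
    have : (p : ℤ) = k * (p / k : ℕ) + (p % k : ℕ) := by exact_mod_cast (Nat.div_add_mod p k).symm
    linear_combination 2 * this
  have large : ∀ p : ℕ, k * k * (2 * (2 * (k * k)) + 5) ≤ p → 2 * ((p : ℤ) + k) ≤ q (2 * p) := by
    intro p hp
    have hkk : 0 < k * k := by positivity
    have ht : 2 * (2 * (k * k)) + 5 ≤ p / (k * k) := by
      rw [Nat.le_div_iff_mul_le hkk, mul_comm]
      exact hp
    have hpow := mul_add_three_le_two_pow (2 * (k * k)) ht
    have hlt : p < k * k * (p / (k * k) + 1) := Nat.lt_mul_div_succ p hkk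
    have hbound : 2 * (p + k) ≤ 2 ^ (p / (k * k)) := by nlinarith
    rw [q_even]
    refine le_trans ?_ (growth _ (Nat.mod_lt p hk) _)
    rw [Nat.div_div_eq_div_mul]
    exact_mod_cast hbound
  refine ⟨2 * ((k * k * (2 * (2 * (k * k)) + 5) + k : ℕ) : ℤ) + 1, ?_⟩
  rintro _ hn ⟨N', rfl⟩
  obtain ⟨N, rfl⟩ : ∃ N : ℕ, N' = N := Int.eq_ofNat_of_zero_le (by lia)
  have hN : k * k * (2 * (2 * (k * k)) + 5) + k ≤ N := by lia
  have hzero : ∀ i ∈ Finset.Icc 1 k,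
      q (2 * (N : ℤ) + 1 - q (2 * (N : ℤ) + 1 - (2 * (i : ℤ) - 1))) = 0 := by
    intro i hi
    rw [Finset.mem_Icc] at hi
    have harg : 2 * (N : ℤ) + 1 - (2 * (i : ℤ) - 1) = 2 * ((N + 1 - i : ℕ) : ℤ) := by lia
    have := large (N + 1 - i) (by lia)
    rw [harg]
    exact hq_neg _ (by lia)
  have hself : q (2 * (N : ℤ) + 1 - q (2 * (N : ℤ) + 1 - 2)) = q (2 * (N : ℤ) + 1) := by
    have hmod := Nat.mod_lt (N - 1) hk
    obtain ⟨c, hc⟩ : ∃ c, c + (N - 1) % k = k := ⟨k - (N - 1) % k, by lia⟩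
    have hck : k * c ≤ N :=
      (Nat.mul_le_mul_left k (by lia : c ≤ k)).trans <|
        (Nat.le_mul_of_pos_right (k * k) (by positivity)).trans ((Nat.le_add_right _ k).trans hN)
    have harg : 2 * (N : ℤ) + 1 - 2 = 2 * ((N - 1 : ℕ) : ℤ) + 1 := by lia
    have hc' : (k : ℤ) - ((N - 1) % k : ℕ) = c := by lia
    have hshift : 2 * (N : ℤ) + 1 - 2 * k * c = 2 * ((N - k * c : ℕ) : ℤ) + 1 := by
      push_cast [hck]
      ring
    rw [harg, q_odd, hc', hshift, q_odd, q_odd, Nat.sub_mul_mod hck]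
  refine ⟨?_, hzero, hself⟩
  rw [hself, Finset.sum_eq_zero fun i hi => by rw [hzero i hi, mul_zero], add_zero]
end

section
/- Fix an integer k ≥ 1 and nonnegative integers b_1, …, b_k with b_1 + ⋯ + b_k ≥ 2, and let (a_n)_{n≥0} be a sequence of positive integers satisfying a_n = Σ_{i=1}^k b_i·a_{n−i} for all n ≥ k. Define the rotated sequences a^(r) and the sequence q : ℤ → ℤ as in the construction. Then there exists H such that for every even integer n ≥ H, q(n) = q(n − q(n−2)) + Σ_{i=1}^k b_i·q(n − q(n−(2i−1))); moreover, for such n, the term q(n − q(n−2)) equals 0. -/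
theorem sum_Icc_one_add_sum_Icc_succ {M : Type*} [AddCommMonoid M] (f : ℕ → M) {r k : ℕ}
    (h : r ≤ k) :
    ∑ i ∈ Finset.Icc 1 r, f i + ∑ i ∈ Finset.Icc (r + 1) k, f i = ∑ i ∈ Finset.Icc 1 k, f i := by
  have key : ∀ x y : ℕ, Finset.Icc (x + 1) y = Finset.Ioc x y := fun x y => by
    ext i
    simp only [Finset.mem_Icc, Finset.mem_Ioc]
    omega
  have := Finset.sum_Ioc_consecutive f (Nat.zero_le r) h
  rwa [← key, ← key, ← key] at this

theorem exists_forall_mul_succ_lt_two_pow (C : ℕ) : ∃ T : ℕ, ∀ t, T ≤ t → C * (t + 1) < 2 ^ t := by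
  refine ⟨4 * C, fun t ht => ?_⟩
  have hu : t / 2 < 2 ^ (t / 2) := Nat.lt_two_pow_self
  have hsq : 2 ^ (t / 2) * 2 ^ (t / 2) ≤ 2 ^ t := by
    rw [← pow_add]
    exact Nat.pow_le_pow_right (by norm_num) (by omega)
  have hC : 2 * C < 2 ^ (t / 2) := by omega
  have ht2 : t + 1 ≤ 2 * 2 ^ (t / 2) := by omega
  nlinarith [Nat.mul_le_mul_left C ht2]

/-- A positive sequence whose terms are weighted sums, of total weight at least two, of terms at
most `k` places earlier at least doubles every `k` steps. -/
theorem two_pow_div_le_of_rec {k : ℕ} (hk : 1 ≤ k) {b : ℕ → ℕ}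
    (hb : 2 ≤ ∑ i ∈ Finset.Icc 1 k, b i) {u : ℕ → ℤ} (hpos : ∀ n < k, 0 < u n) {d : ℕ → ℕ}
    (hd : ∀ i ∈ Finset.Icc 1 k, 1 ≤ d i ∧ d i ≤ k)
    (hrec : ∀ n, k ≤ n → u n = ∑ i ∈ Finset.Icc 1 k, (b i : ℤ) * u (n - d i)) (n : ℕ) :
    (2 : ℤ) ^ (n / k) ≤ u n := by
  induction n using Nat.strong_induction_on with
  | _ n ih =>
    rcases lt_or_ge n k with hn | hn
    · rw [Nat.div_eq_of_lt hn]
      simpa using Int.add_one_le_iff.2 (hpos n hn)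
    · have hdiv : n / k = (n - k) / k + 1 := Nat.div_eq_sub_div (by omega) hn
      have hbZ : (2 : ℤ) ≤ ∑ i ∈ Finset.Icc 1 k, (b i : ℤ) := by exact_mod_cast hb
      calc (2 : ℤ) ^ (n / k) = 2 * 2 ^ ((n - k) / k) := by rw [hdiv, pow_succ, mul_comm]
        _ ≤ (∑ i ∈ Finset.Icc 1 k, (b i : ℤ)) * 2 ^ ((n - k) / k) := by gcongr
        _ = ∑ i ∈ Finset.Icc 1 k, (b i : ℤ) * 2 ^ ((n - k) / k) := Finset.sum_mul ..
        _ ≤ ∑ i ∈ Finset.Icc 1 k, (b i : ℤ) * u (n - d i) := by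
          refine Finset.sum_le_sum fun i hi => mul_le_mul_of_nonneg_left ?_ (by positivity)
          have := hd i hi
          refine le_trans ?_ (ih (n - d i) (by omega))
          exact pow_le_pow_right₀ (by norm_num) (Nat.div_le_div_right (by omega))
        _ = u n := (hrec n hn).symm

theorem exists_eq_two_mul_mul_add {k : ℕ} (hk : 1 ≤ k) {n : ℤ} (hn : 0 ≤ n) (he : Even n) :
    ∃ m j : ℕ, j < k ∧ n = 2 * (m : ℤ) * k + 2 * j := by
  obtain ⟨c, rfl⟩ := he
  lift c to ℕ using by omega
  refine ⟨c / k, c % k, Nat.mod_lt _ hk, ?_⟩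
  have h : ((k * (c / k) + c % k : ℕ) : ℤ) = c := by rw [Nat.div_add_mod]
  push_cast at h ⊢
  linarith

/-- For all sufficiently large even `n`, the constructed sequence `q`
satisfies the meta-Fibonacci recurrence; moreover the term `q (n - q (n-2))` vanishes. -/
theorem even_case_of_construction
    (k : ℕ) (hk : 1 ≤ k) (b : ℕ → ℕ)
    (hb : 2 ≤ ∑ i ∈ Finset.Icc 1 k, b i)
    (a : ℕ → ℤ) (ha_pos : ∀ n, 0 < a n)
    (ha_rec : ∀ n, k ≤ n → a n = ∑ i ∈ Finset.Icc 1 k, (b i : ℤ) * a (n - i))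
    (A : ℕ → ℕ → ℤ)
    (hA_init : ∀ r < k, ∀ n < k, A r n = a n)
    (hA_rec : ∀ r < k, ∀ n, k ≤ n →
      A r n = (∑ i ∈ Finset.Icc 1 r, (b i : ℤ) * A r (n - (k + i - r)))
            + (∑ i ∈ Finset.Icc (r + 1) k, (b i : ℤ) * A r (n - (i - r))))
    (q : ℤ → ℤ)
    (hq_neg : ∀ m : ℤ, m < 0 → q m = 0)
    (hq_even : ∀ m : ℕ, ∀ j < k, q (2 * (m : ℤ) * k + 2 * j) = A j m)
    (hq_odd : ∀ m : ℕ, ∀ j < k, q (2 * (m : ℤ) * k + 2 * j + 1) = 2 * k * ((k : ℤ) - j)) :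
    ∃ H : ℤ, ∀ n : ℤ, H ≤ n → Even n →
      (q n = q (n - q (n - 2)) +
        ∑ i ∈ Finset.Icc 1 k, (b i : ℤ) * q (n - q (n - (2 * (i : ℤ) - 1)))) ∧
      q (n - q (n - 2)) = 0 := by
  let d : ℕ → ℕ → ℕ := fun r i => if i ≤ r then k + i - r else i - r
  have hd : ∀ r < k, ∀ i ∈ Finset.Icc 1 k, 1 ≤ d r i ∧ d r i ≤ k := by
    intro r hr i hi
    rw [Finset.mem_Icc] at hi
    simp only [d]
    split_ifs <;> omega
  have hrec : ∀ r < k, ∀ n, k ≤ n →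
      A r n = ∑ i ∈ Finset.Icc 1 k, (b i : ℤ) * A r (n - d r i) := by
    intro r hr n hn
    rw [hA_rec r hr n hn, ← sum_Icc_one_add_sum_Icc_succ _ hr.le]
    congr 1 <;> refine Finset.sum_congr rfl fun i hi => ?_ <;> rw [Finset.mem_Icc] at hi
    · simp only [d, if_pos hi.2]
    · simp only [d, if_neg (show ¬ i ≤ r by omega)]
  have hgrow : ∀ r < k, ∀ n, (2 : ℤ) ^ (n / k) ≤ A r n := fun r hr n =>
    two_pow_div_le_of_rec hk hb (fun n hn => hA_init r hr n hn ▸ ha_pos n) (hd r hr) (hrec r hr) n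
  obtain ⟨T, hT⟩ := exists_forall_mul_succ_lt_two_pow (2 * k * k)
  refine ⟨2 * k * (k * T + k + 1) + 2, fun n hn he => ?_⟩
  have hbound : (0 : ℤ) ≤ 2 * k * (k * T + k + 1) := by positivity
  have hn0 : 0 ≤ n - 2 := by linarith
  have hzero : q (n - q (n - 2)) = 0 := by
    obtain ⟨m, j, hj, hmj⟩ := exists_eq_two_mul_mul_add hk hn0 (he.sub even_two)
    apply hq_neg
    rw [hmj, hq_even m j hj]
    have hm : k * T ≤ m := by
      by_contra! hlt
      have h1 : ((m : ℤ) + 1) * k ≤ (k * T) * k := by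
        gcongr
        exact_mod_cast hlt
      have hj' : (j : ℤ) < k := by exact_mod_cast hj
      nlinarith
    have hTm : T ≤ m / k := (Nat.le_div_iff_mul_le hk).2 (by linarith)
    have h1 := hT _ hTm
    have h2 : m + 1 ≤ k * (m / k + 1) := by
      have := Nat.lt_mul_div_succ m (show 0 < k from hk)
      exact this
    have h3 : 2 * k * (m + 1) < 2 ^ (m / k) := by
      refine lt_of_le_of_lt ?_ h1
      calc 2 * k * (m + 1) ≤ 2 * k * (k * (m / k + 1)) := Nat.mul_le_mul_left _ h2
        _ = 2 * k * k * (m / k + 1) := by ring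
    have h4 : 2 * (k : ℤ) * (m + 1) < 2 ^ (m / k) := by exact_mod_cast h3
    have h5 := hgrow j hj m
    have hj' : (j : ℤ) + 1 ≤ k := by exact_mod_cast hj
    linarith
  refine ⟨?_, hzero⟩
  obtain ⟨m, j, hj, rfl⟩ := exists_eq_two_mul_mul_add hk (show 0 ≤ n by linarith) he
  have hj' : (j : ℤ) + 1 ≤ k := by exact_mod_cast hj
  have hkm : k ≤ m := by
    by_contra! hlt
    have h1 : ((m : ℤ) + 1) * k ≤ k * k := by
      gcongr
      exact_mod_cast hlt
    have h2 : (0 : ℤ) ≤ k * (k * T) := by positivity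
    nlinarith
  rw [hzero, zero_add, hq_even m j hj, hrec j hj m hkm]
  refine Finset.sum_congr rfl fun i hi => ?_
  have hdi := hd j hj i hi
  rw [Finset.mem_Icc] at hi
  have hq : q (2 * (m : ℤ) * k + 2 * j - (2 * (i : ℤ) - 1)) = 2 * k * (d j i : ℤ) := by
    by_cases hij : i ≤ j
    · have h := hq_odd m (j - i) (by omega)
      simp only [d, if_pos hij]
      rw [Nat.cast_sub hij] at h
      rw [Nat.cast_sub (by omega), Nat.cast_add]
      convert h using 2 <;> ring
    · have h := hq_odd (m - 1) (k + j - i) (by omega)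
      simp only [d, if_neg hij]
      rw [Nat.cast_sub (show i ≤ k + j by omega), Nat.cast_sub (show 1 ≤ m by omega)] at h
      rw [Nat.cast_sub (by omega)]
      push_cast at h
      convert h using 2 <;> ring
  have h := hq_even (m - d j i) j hj
  rw [Nat.cast_sub (by omega)] at h
  rw [hq, ← h]
  congr 2
  ring
end

section
/- Let F denote the Fibonacci numbers with F(1) = F(2) = 1. Define q : ℤ → ℤ by q(4m) = F(m+5), q(4m+1) = 8, q(4m+2) = F(m+5), and q(4m+3) = 4 for all integers m ≥ 0, and q(m) = 0 for all m < 0 (so q begins 5, 8, 5, 4, 8, 8, 8, 4, 13, 8, 13, 4, 21, 8, 21, 4, …). Then q eventually satisfies the meta-Fibonacci recurrence q(n) = q(n − q(n−1)) + q(n − q(n−2)) + q(n − q(n−3)): there exists N such that this equation holds for all n ≥ N. In particular, the Fibonacci numbers starting from 5 occur as the subsequence q(4n) of quasi-period 4. -/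
/-- Fibonacci numbers outgrow a linear function of slope four. -/
theorem four_mul_add_twenty_le_fib (k : ℕ) : 4 * k + 20 ≤ Nat.fib (k + 8) := by
  induction k using Nat.twoStepInduction with
  | zero => decide
  | one => decide
  | more k ih₀ ih₁ =>
    have h : Nat.fib (k + 2 + 8) = Nat.fib (k + 8) + Nat.fib (k + 1 + 8) :=
      Nat.fib_add_two (n := k + 8)
    omega


/-- The sequence `5, 8, 5, 4, 8, 8, 8, 4, 13, 8, 13, 4, …` built from the
Fibonacci numbers eventually satisfies Hofstadter's recurrence with three terms,
and contains the Fibonacci numbers from 5 on as the subsequence `q (4n)`. -/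
theorem fibonacci_construction
    (q : ℤ → ℤ)
    (hq_neg : ∀ m : ℤ, m < 0 → q m = 0)
    (hq0 : ∀ m : ℕ, q (4 * (m : ℤ)) = Nat.fib (m + 5))
    (hq1 : ∀ m : ℕ, q (4 * (m : ℤ) + 1) = 8)
    (hq2 : ∀ m : ℕ, q (4 * (m : ℤ) + 2) = Nat.fib (m + 5))
    (hq3 : ∀ m : ℕ, q (4 * (m : ℤ) + 3) = 4) :
    (∃ N : ℤ, ∀ n : ℤ, N ≤ n →
      q n = q (n - q (n - 1)) + q (n - q (n - 2)) + q (n - q (n - 3))) ∧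
    (∀ n : ℕ, q (4 * (n : ℤ)) = Nat.fib (n + 5)) := by
  refine ⟨⟨16, fun n hn => ?_⟩, hq0⟩
  obtain ⟨k, hk⟩ : ∃ k : ℕ, n / 4 = k + 4 := ⟨(n / 4 - 4).toNat, by omega⟩
  have growth : (4 * k + 20 : ℤ) ≤ Nat.fib (k + 3 + 5) := by
    exact_mod_cast four_mul_add_twenty_le_fib k
  have fib_rec : (Nat.fib (k + 4 + 5) : ℤ) = Nat.fib (k + 2 + 5) + Nat.fib (k + 3 + 5) := by
    exact_mod_cast Nat.fib_add_two (n := k + 7)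
  have fib_mono : (Nat.fib (k + 3 + 5) : ℤ) ≤ Nat.fib (k + 4 + 5) := by
    exact_mod_cast Nat.fib_le_fib_succ
  have val0 (j : ℕ) (x : ℤ) (hx : x = 4 * j) : q x = Nat.fib (j + 5) := hx ▸ hq0 j
  have val1 (j : ℕ) (x : ℤ) (hx : x = 4 * j + 1) : q x = 8 := hx ▸ hq1 j
  have val2 (j : ℕ) (x : ℤ) (hx : x = 4 * j + 2) : q x = Nat.fib (j + 5) := hx ▸ hq2 j
  have val3 (j : ℕ) (x : ℤ) (hx : x = 4 * j + 3) : q x = 4 := hx ▸ hq3 j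
  obtain h | h | h | h : n % 4 = 0 ∨ n % 4 = 1 ∨ n % 4 = 2 ∨ n % 4 = 3 := by omega
  · rw [val3 (k + 3) (n - 1) (by omega), val2 (k + 3) (n - 2) (by omega),
      val1 (k + 3) (n - 3) (by omega), val0 (k + 4) n (by omega),
      val0 (k + 3) (n - 4) (by omega), val0 (k + 2) (n - 8) (by omega),
      hq_neg _ (by omega)]
    linarith
  · rw [val0 (k + 4) (n - 1) (by omega), val3 (k + 3) (n - 2) (by omega),
      val2 (k + 3) (n - 3) (by omega), val1 (k + 4) n (by omega),
      val1 (k + 3) (n - 4) (by omega), hq_neg (n - Nat.fib (k + 4 + 5)) (by omega),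
      hq_neg (n - Nat.fib (k + 3 + 5)) (by omega)]
    norm_num
  · rw [val1 (k + 4) (n - 1) (by omega), val0 (k + 4) (n - 2) (by omega),
      val3 (k + 3) (n - 3) (by omega), val2 (k + 4) n (by omega),
      val2 (k + 2) (n - 8) (by omega), val2 (k + 3) (n - 4) (by omega),
      hq_neg _ (by omega)]
    linarith
  · rw [val2 (k + 4) (n - 1) (by omega), val1 (k + 4) (n - 2) (by omega),
      val0 (k + 4) (n - 3) (by omega), val3 (k + 4) n (by omega),
      val3 (k + 2) (n - 8) (by omega), hq_neg (n - Nat.fib (k + 4 + 5)) (by omega)]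
    norm_num
end

section
/- Define three sequences of positive integers, each with initial values 30, 40, 60: a^(0)_0 = a^(1)_0 = a^(2)_0 = 30, a^(0)_1 = a^(1)_1 = a^(2)_1 = 40, a^(0)_2 = a^(1)_2 = a^(2)_2 = 60, and for n ≥ 3: a^(0)_n = a^(0)_{n−1} + 2·a^(0)_{n−3}, a^(1)_n = a^(1)_{n−3} + 2·a^(1)_{n−2}, a^(2)_n = a^(2)_{n−2} + 2·a^(2)_{n−1}. Define q : ℤ → ℤ by q(6m+2j) = a^(j)_m and q(6m+2j+1) = 6(3−j) for all integers m ≥ 0 and 0 ≤ j < 3, and q(m) = 0 for m < 0 (so q begins 30, 18, 30, 12, 30, 6, 40, 18, 40, 12, 40, 6, 60, 18, 60, 12, 60, 6, …). Then for all n ≥ 18, q(n) = q(n − q(n−1)) + q(n − q(n−2)) + 2·q(n − q(n−5)). -/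
/-- A sequence dominates `6 * n + 12` if its first three terms do and each later term is at
least `x + 2 * y` with `x`, `y` among the three preceding terms. -/
theorem linear_lower_bound (f : ℕ → ℤ) (h0 : 30 ≤ f 0) (h1 : 40 ≤ f 1) (h2 : 60 ≤ f 2)
    (hstep : ∀ n, ∃ i < 3, ∃ j < 3, f (n + 3) = f (n + i) + 2 * f (n + j)) (n : ℕ) :
    6 * (n : ℤ) + 12 ≤ f n := by
  induction n using Nat.strong_induction_on with
  | _ n ih =>
    match n with
    | 0 => push_cast; omega
    | 1 => push_cast; omega
    | 2 => push_cast; omega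
    | n + 3 =>
      obtain ⟨i, hi, j, hj, h⟩ := hstep n
      have hfi := ih (n + i) (by omega)
      have hfj := ih (n + j) (by omega)
      push_cast at hfi hfj ⊢
      omega


/-- The example: three rotated sequences with initial values 30, 40, 60
interleaved with the odd-indexed values 18, 12, 6 satisfy
`q n = q (n - q (n-1)) + q (n - q (n-2)) + 2 * q (n - q (n-5))` for all `n ≥ 18`. -/
theorem example_construction
    (A : ℕ → ℕ → ℤ)
    (hA0 : ∀ j : ℕ, j < 3 → A j 0 = 30)
    (hA1 : ∀ j : ℕ, j < 3 → A j 1 = 40)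
    (hA2 : ∀ j : ℕ, j < 3 → A j 2 = 60)
    (hApos : ∀ j : ℕ, j < 3 → ∀ n : ℕ, 0 < A j n)
    (hrec0 : ∀ n : ℕ, 3 ≤ n → A 0 n = A 0 (n - 1) + 2 * A 0 (n - 3))
    (hrec1 : ∀ n : ℕ, 3 ≤ n → A 1 n = A 1 (n - 3) + 2 * A 1 (n - 2))
    (hrec2 : ∀ n : ℕ, 3 ≤ n → A 2 n = A 2 (n - 2) + 2 * A 2 (n - 1))
    (q : ℤ → ℤ)
    (hq_neg : ∀ m : ℤ, m < 0 → q m = 0)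
    (hq_even : ∀ m : ℕ, ∀ j : ℕ, j < 3 → q (6 * (m : ℤ) + 2 * (j : ℤ)) = A j m)
    (hq_odd : ∀ m : ℕ, ∀ j : ℕ, j < 3 → q (6 * (m : ℤ) + 2 * (j : ℤ) + 1) = 6 * (3 - (j : ℤ))) :
    ∀ n : ℤ, 18 ≤ n →
      q n = q (n - q (n - 1)) + q (n - q (n - 2)) + 2 * q (n - q (n - 5)) := by
  have rec0 (k : ℕ) : A 0 (k + 3) = A 0 (k + 2) + 2 * A 0 k := hrec0 (k + 3) (by omega)
  have rec1 (k : ℕ) : A 1 (k + 3) = A 1 k + 2 * A 1 (k + 1) := hrec1 (k + 3) (by omega)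
  have rec2 (k : ℕ) : A 2 (k + 3) = A 2 (k + 1) + 2 * A 2 (k + 2) := hrec2 (k + 3) (by omega)
  have bound (j : ℕ) (hj : j < 3) (m : ℕ) : 6 * (m : ℤ) + 12 ≤ A j m := by
    refine linear_lower_bound (A j) (hA0 j hj).ge (hA1 j hj).ge (hA2 j hj).ge (fun k ↦ ?_) m
    interval_cases j
    · exact ⟨2, by omega, 0, by omega, rec0 k⟩
    · exact ⟨0, by omega, 1, by omega, rec1 k⟩
    · exact ⟨1, by omega, 2, by omega, rec2 k⟩
  have even (j : ℕ) (hj : j < 3) (m : ℕ) (x : ℤ) (hx : x = 6 * m + 2 * j) : q x = A j m :=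
    hx ▸ hq_even m j hj
  have odd (j : ℕ) (hj : j < 3) (m : ℕ) (x : ℤ) (hx : x = 6 * m + 2 * j + 1) :
      q x = 6 * (3 - j) := hx ▸ hq_odd m j hj
  have step (n x y z u v w : ℤ) (hx : q (n - 1) = x) (hy : q (n - 2) = y) (hz : q (n - 5) = z)
      (hu : q (n - x) = u) (hv : q (n - y) = v) (hw : q (n - z) = w) (h : q n = u + v + 2 * w) :
      q n = q (n - q (n - 1)) + q (n - q (n - 2)) + 2 * q (n - q (n - 5)) := by
    rw [hx, hy, hz, hu, hv, hw, h]
  intro n hn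
  obtain ⟨k, r, hr, rfl⟩ : ∃ k r : ℕ, r < 6 ∧ n = 6 * (k + 3 : ℕ) + r :=
    ⟨((n - 18) / 6).toNat, (n % 6).toNat, by omega, by omega⟩
  have b0 := bound 0 (by omega) (k + 3)
  have b1 := bound 1 (by omega) (k + 3)
  have b2 := bound 2 (by omega) (k + 3)
  have c1 := bound 1 (by omega) (k + 2)
  have c2 := bound 2 (by omega) (k + 2)
  push_cast at b0 b1 b2 c1 c2
  interval_cases r
  · refine step _ _ _ _ _ _ _
      (odd 2 (by omega) (k + 2) _ (by push_cast; ring))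
      (even 2 (by omega) (k + 2) _ (by push_cast; ring))
      (odd 0 (by omega) (k + 2) _ (by push_cast; ring))
      (even 0 (by omega) (k + 2) _ (by push_cast; ring))
      (hq_neg _ (by push_cast; omega))
      (even 0 (by omega) k _ (by push_cast; ring)) ?_
    rw [even 0 (by omega) (k + 3) _ (by push_cast; ring), rec0]
    ring
  · refine step _ _ _ _ _ _ _
      (even 0 (by omega) (k + 3) _ (by push_cast; ring))
      (odd 2 (by omega) (k + 2) _ (by push_cast; ring))
      (even 1 (by omega) (k + 2) _ (by push_cast; ring))
      (hq_neg _ (by push_cast; omega))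
      (odd 0 (by omega) (k + 2) _ (by push_cast; ring))
      (hq_neg _ (by push_cast; omega)) ?_
    rw [odd 0 (by omega) (k + 3) _ (by push_cast; ring)]
    norm_num
  · refine step _ _ _ _ _ _ _
      (odd 0 (by omega) (k + 3) _ (by push_cast; ring))
      (even 0 (by omega) (k + 3) _ (by push_cast; ring))
      (odd 1 (by omega) (k + 2) _ (by push_cast; ring))
      (even 1 (by omega) k _ (by push_cast; ring))
      (hq_neg _ (by push_cast; omega))
      (even 1 (by omega) (k + 1) _ (by push_cast; ring)) ?_
    rw [even 1 (by omega) (k + 3) _ (by push_cast; ring), rec1]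
    ring
  · refine step _ _ _ _ _ _ _
      (even 1 (by omega) (k + 3) _ (by push_cast; ring))
      (odd 0 (by omega) (k + 3) _ (by push_cast; ring))
      (even 2 (by omega) (k + 2) _ (by push_cast; ring))
      (hq_neg _ (by push_cast; omega))
      (odd 1 (by omega) k _ (by push_cast; ring))
      (hq_neg _ (by push_cast; omega)) ?_
    rw [odd 1 (by omega) (k + 3) _ (by push_cast; ring)]
    norm_num
  · refine step _ _ _ _ _ _ _
      (odd 1 (by omega) (k + 3) _ (by push_cast; ring))
      (even 1 (by omega) (k + 3) _ (by push_cast; ring))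
      (odd 2 (by omega) (k + 2) _ (by push_cast; ring))
      (even 2 (by omega) (k + 1) _ (by push_cast; ring))
      (hq_neg _ (by push_cast; omega))
      (even 2 (by omega) (k + 2) _ (by push_cast; ring)) ?_
    rw [even 2 (by omega) (k + 3) _ (by push_cast; ring), rec2]
    ring
  · refine step _ _ _ _ _ _ _
      (even 2 (by omega) (k + 3) _ (by push_cast; ring))
      (odd 1 (by omega) (k + 3) _ (by push_cast; ring))
      (even 0 (by omega) (k + 3) _ (by push_cast; ring))
      (hq_neg _ (by push_cast; omega))
      (odd 2 (by omega) (k + 1) _ (by push_cast; ring))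
      (hq_neg _ (by push_cast; omega)) ?_
    rw [odd 2 (by omega) (k + 3) _ (by push_cast; ring)]
    norm_num
end
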